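/- Let I ⊆ ℝ be an open interval, U : I → ℂ smooth, M ≥ 1, and let φ₁, …, φ_M : I → ℂ be smooth functions satisfying −φⱼ''(x) + U(x)φⱼ(x) = Ẽⱼ·φⱼ(x) (j = 1,…,M) for all x ∈ I, with Ẽ₁,…,Ẽ_M ∈ ℂ. Assume W(x) := W[φ₁,…,φ_M](x) ≠ 0 for all x ∈ I, and define U⁽ᴹ⁾(x) := U(x) − 2(W''(x)/W(x) − (W'(x)/W(x))²). Then for each j ∈ {1,…,M}, the function φⱼ⁽ᴹ⁾(x) := W[φ₁,…,φ_{j−1},φ_{j+1},…,φ_M](x)/W(x) (the Wronskian with φⱼ omitted, divided by W) satisfies −(φⱼ⁽ᴹ⁾)''(x) + U⁽ᴹ⁾(x)φⱼ⁽ᴹ⁾(x) = Ẽⱼ·φⱼ⁽ᴹ⁾(x) for all x ∈ I. -/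

import Mathlib

/-- The Wronskian of `n` functions: determinant of the matrix whose `(j,k)` entry is the
`j`-th derivative (0-based) of the `k`-th function. -/
noncomputable def wronskian (n : ℕ) (f : Fin n → ℝ → ℂ) (x : ℝ) : ℂ :=
  (Matrix.of fun j k : Fin n => iteratedDeriv (j : ℕ) (f k) x).det

open scoped ContDiff Topology

/-- Jacobi's formula, row by row. -/
theorem hasDerivAt_det {ι 𝕜 𝔸 : Type*} [Fintype ι] [DecidableEq ι] [NontriviallyNormedField 𝕜]
    [NormedCommRing 𝔸] [NormedAlgebra 𝕜 𝔸] {A : 𝕜 → Matrix ι ι 𝔸} {A' : Matrix ι ι 𝔸} {x : 𝕜}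
    (h : ∀ i k, HasDerivAt (fun y => A y i k) (A' i k) x) :
    HasDerivAt (fun y => (A y).det) (∑ i, ((A x).updateRow i (A' i)).det) x := by
  have key : HasDerivAt (fun y => ∑ σ : Equiv.Perm ι,
      ((Equiv.Perm.sign σ : ℤ) : 𝔸) * ∏ i, A y i (σ i))
      (∑ σ : Equiv.Perm ι, ((Equiv.Perm.sign σ : ℤ) : 𝔸) *
        ∑ i, (∏ j ∈ Finset.univ.erase i, A x j (σ j)) • A' i (σ i)) x :=
    HasDerivAt.fun_sum fun σ _ =>
      (HasDerivAt.fun_finsetProd fun i _ => h i (σ i)).const_mul _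
  convert key using 1
  · ext y
    rw [← Matrix.det_transpose, Matrix.det_apply']
    rfl
  · simp_rw [Finset.mul_sum]
    rw [Finset.sum_comm]
    refine Finset.sum_congr rfl fun i _ => ?_
    rw [← Matrix.det_transpose, Matrix.det_apply']
    refine Finset.sum_congr rfl fun σ _ => ?_
    rw [← Finset.mul_prod_erase _ _ (Finset.mem_univ i)]
    simp only [Matrix.transpose_apply, Matrix.updateRow_self, smul_eq_mul]
    rw [mul_comm (A' i (σ i))]
    congr 2
    refine Finset.prod_congr rfl fun j hj => ?_
    rw [Matrix.updateRow_ne (Finset.ne_of_mem_erase hj)]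

theorem ContDiffOn.iteratedDeriv_of_isOpen {f : ℝ → ℂ} {s : Set ℝ} (hs : IsOpen s)
    (hf : ContDiffOn ℝ ∞ f s) (n : ℕ) : ContDiffOn ℝ ∞ (iteratedDeriv n f) s := by
  induction n with
  | zero => simpa using hf
  | succ n ih =>
    rw [iteratedDeriv_succ]
    exact ((contDiffOn_infty_iff_deriv_of_isOpen hs).1 ih).2

theorem contDiffOn_wronskian {n : ℕ} {f : Fin n → ℝ → ℂ} {s : Set ℝ} (hs : IsOpen s)
    (hf : ∀ k, ContDiffOn ℝ ∞ (f k) s) : ContDiffOn ℝ ∞ (wronskian n f) s := by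
  have : wronskian n f = fun x => ∑ σ : Equiv.Perm (Fin n),
      ((Equiv.Perm.sign σ : ℤ) : ℂ) * ∏ i, iteratedDeriv (σ i : ℕ) (f i) x := by
    ext x
    rw [wronskian, Matrix.det_apply']
    rfl
  rw [this]
  exact ContDiffOn.sum fun σ _ => contDiffOn_const.mul
    (contDiffOn_prod fun i _ => (hf i).iteratedDeriv_of_isOpen hs _)

/-- The derivative of a Wronskian is obtained by differentiating its last row. -/
theorem deriv_wronskian {m : ℕ} {φ : Fin (m + 1) → ℝ → ℂ} {s : Set ℝ} (hs : IsOpen s)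
    (hφ : ∀ k, ContDiffOn ℝ ∞ (φ k) s) {x : ℝ} (hx : x ∈ s) :
    deriv (wronskian (m + 1) φ) x =
      ((Matrix.of fun j k : Fin (m + 1) => iteratedDeriv (j : ℕ) (φ k) x).updateRow (Fin.last m)
        fun k => iteratedDeriv (m + 1) (φ k) x).det := by
  have h := hasDerivAt_det
    (A := fun y => Matrix.of fun j k : Fin (m + 1) => iteratedDeriv (j : ℕ) (φ k) y)
    (A' := Matrix.of fun j k : Fin (m + 1) => iteratedDeriv (j + 1 : ℕ) (φ k) x) (x := x) ?_
  · refine h.deriv.trans ?_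
    rw [Fin.sum_univ_castSucc, Finset.sum_eq_zero, zero_add]
    · rfl
    · intro i _
      exact Matrix.det_updateRow_eq_zero
        (M := Matrix.of fun j k : Fin (m + 1) => iteratedDeriv (j : ℕ) (φ k) x)
        (i := i.succ) (j := i.castSucc) (Fin.castSucc_lt_succ).ne'
  · intro i k
    simp only [Matrix.of_apply, iteratedDeriv_succ]
    exact ((((hφ k).iteratedDeriv_of_isOpen hs i).contDiffAt (hs.mem_nhds hx)).differentiableAt
      (by simp)).hasDerivAt

/-- The last column of the inverse of the Wronskian matrix of `φ`. -/
noncomputable def wronskianDual {m : ℕ} (φ : Fin (m + 1) → ℝ → ℂ) (k : Fin (m + 1)) (x : ℝ) : ℂ :=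
  (-1) ^ (m + k : ℕ) * (wronskian m (fun i => φ (k.succAbove i)) x / wronskian (m + 1) φ x)

theorem contDiffOn_wronskianDual {m : ℕ} {φ : Fin (m + 1) → ℝ → ℂ} {s : Set ℝ} (hs : IsOpen s)
    (hφ : ∀ k, ContDiffOn ℝ ∞ (φ k) s) (hW : ∀ x ∈ s, wronskian (m + 1) φ x ≠ 0)
    (k : Fin (m + 1)) : ContDiffOn ℝ ∞ (wronskianDual φ k) s := by
  unfold wronskianDual
  simp only [div_eq_mul_inv]
  exact contDiffOn_const.mul <|
    (contDiffOn_wronskian hs fun i => hφ _).mul ((contDiffOn_wronskian hs hφ).inv hW)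

theorem sum_mul_wronskianDual {m : ℕ} (φ : Fin (m + 1) → ℝ → ℂ) (x : ℝ) (r : Fin (m + 1) → ℂ) :
    ∑ k, r k * wronskianDual φ k x =
      ((Matrix.of fun j k : Fin (m + 1) => iteratedDeriv (j : ℕ) (φ k) x).updateRow
        (Fin.last m) r).det / wronskian (m + 1) φ x := by
  rw [Matrix.det_succ_row _ (Fin.last m), Finset.sum_div]
  refine Finset.sum_congr rfl fun k _ => ?_
  rw [Matrix.updateRow_self, Matrix.submatrix_updateRow_succAbove, wronskianDual]
  have : ((Matrix.of fun j k : Fin (m + 1) => iteratedDeriv (j : ℕ) (φ k) x).submatrix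
      (Fin.last m).succAbove k.succAbove).det = wronskian m (fun i => φ (k.succAbove i)) x := by
    rw [wronskian]
    congr 1
    ext i l
    simp
  rw [this, Fin.val_last]
  ring

theorem sum_iteratedDeriv_mul_wronskianDual {m : ℕ} {φ : Fin (m + 1) → ℝ → ℂ} {x : ℝ}
    (hW : wronskian (m + 1) φ x ≠ 0) {i : ℕ} (hi : i ≤ m) :
    ∑ k, iteratedDeriv i (φ k) x * wronskianDual φ k x = if i = m then 1 else 0 := by
  rw [sum_mul_wronskianDual]
  split_ifs with h
  · subst h
    rw [div_eq_one_iff_eq hW, wronskian]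
    congr 1
    exact Matrix.updateRow_eq_self
      (Matrix.of fun j k : Fin (i + 1) => iteratedDeriv (j : ℕ) (φ k) x) (Fin.last i)
  · rw [div_eq_zero_iff]
    left
    exact Matrix.det_updateRow_eq_zero
      (M := Matrix.of fun j k : Fin (m + 1) => iteratedDeriv (j : ℕ) (φ k) x)
      (i := (⟨i, by omega⟩ : Fin (m + 1))) (j := Fin.last m) (by simpa [Fin.ext_iff] using h)

theorem sum_iteratedDeriv_succ_mul_wronskianDual {m : ℕ} {φ : Fin (m + 1) → ℝ → ℂ} {s : Set ℝ}
    (hs : IsOpen s) (hφ : ∀ k, ContDiffOn ℝ ∞ (φ k) s) {x : ℝ} (hx : x ∈ s) :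
    ∑ k, iteratedDeriv (m + 1) (φ k) x * wronskianDual φ k x =
      deriv (wronskian (m + 1) φ) x / wronskian (m + 1) φ x := by
  rw [sum_mul_wronskianDual, deriv_wronskian hs hφ hx]

theorem deriv_sum_mul {ι : Type*} {t : Finset ι} {f g : ι → ℝ → ℂ} {s : Set ℝ}
    (hs : IsOpen s) (hf : ∀ k, ContDiffOn ℝ ∞ (f k) s) (hg : ∀ k, ContDiffOn ℝ ∞ (g k) s)
    {x : ℝ} (hx : x ∈ s) :
    deriv (fun y => ∑ k ∈ t, f k y * g k y) x =
      ∑ k ∈ t, deriv (f k) x * g k x + ∑ k ∈ t, f k x * deriv (g k) x := by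
  rw [← Finset.sum_add_distrib]
  have hd {h : ℝ → ℂ} (hh : ContDiffOn ℝ ∞ h s) : HasDerivAt h (deriv h x) x :=
    ((hh.contDiffAt (hs.mem_nhds hx)).differentiableAt (by simp)).hasDerivAt
  exact (HasDerivAt.fun_sum fun k _ => (hd (hf k)).mul (hd (hg k))).deriv

/-- The derivatives of a solution of a Schrödinger equation, by the Leibniz rule. -/
theorem iteratedDeriv_schrodinger {f U : ℝ → ℂ} {E : ℂ} {s : Set ℝ} (hs : IsOpen s)
    (hU : ContDiffOn ℝ ∞ U s) (hf : ContDiffOn ℝ ∞ f s)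
    (h : ∀ x ∈ s, -(deriv (deriv f) x) + U x * f x = E * f x) (i : ℕ) {x : ℝ} (hx : x ∈ s) :
    E * iteratedDeriv i f x = -iteratedDeriv (i + 2) f x +
      ∑ l ∈ Finset.range (i + 1), (i.choose l) * iteratedDeriv l U x *
        iteratedDeriv (i - l) f x := by
  have hU' : ContDiffAt ℝ i U x :=
    (hU.contDiffAt (hs.mem_nhds hx)).of_le (by exact_mod_cast le_top)
  have hf' : ContDiffAt ℝ i f x :=
    (hf.contDiffAt (hs.mem_nhds hx)).of_le (by exact_mod_cast le_top)
  rw [← iteratedDeriv_mul hU' hf', iteratedDeriv_succ', iteratedDeriv_succ']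
  have he : deriv (deriv f) =ᶠ[𝓝 x] U * f + fun y => -E * f y := by
    filter_upwards [hs.mem_nhds hx] with y hy
    simp only [Pi.add_apply, Pi.mul_apply]
    linear_combination -h y hy
  rw [(he.iteratedDeriv i).eq_of_nhds, iteratedDeriv_add (f := U * f) (hU'.mul hf') (contDiffAt_const.mul hf'),
    iteratedDeriv_const_mul (-E) hf']
  ring

theorem schrodinger_wronskianDual {m : ℕ} {U : ℝ → ℂ} {φ : Fin (m + 1) → ℝ → ℂ}
    {F : Fin (m + 1) → ℂ} {s : Set ℝ} (hs : IsOpen s) (hU : ContDiffOn ℝ ∞ U s)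
    (hφ : ∀ j, ContDiffOn ℝ ∞ (φ j) s)
    (heqφ : ∀ j, ∀ x ∈ s, -(deriv (deriv (φ j)) x) + U x * φ j x = F j * φ j x)
    (hW : ∀ x ∈ s, wronskian (m + 1) φ x ≠ 0) {x : ℝ} (hx : x ∈ s) (j : Fin (m + 1)) :
    -(deriv (deriv (wronskianDual φ j)) x) +
        (U x - 2 * deriv (fun y => deriv (wronskian (m + 1) φ) y / wronskian (m + 1) φ y) x) *
          wronskianDual φ j x = F j * wronskianDual φ j x := by
  set ψ := wronskianDual φ
  set w' := deriv (fun y => deriv (wronskian (m + 1) φ) y / wronskian (m + 1) φ y) x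
  have hφ' (i : ℕ) (k : Fin (m + 1)) := (hφ k).iteratedDeriv_of_isOpen hs i
  have hψ (k : Fin (m + 1)) : ContDiffOn ℝ ∞ (ψ k) s := contDiffOn_wronskianDual hs hφ hW k
  have hψ' (k : Fin (m + 1)) : ContDiffOn ℝ ∞ (deriv (ψ k)) s :=
    ((contDiffOn_infty_iff_deriv_of_isOpen hs).1 (hψ k)).2
  set p : ℕ → ℝ → ℂ := fun i y => ∑ k, iteratedDeriv i (φ k) y * ψ k y with hp
  have hp0 {i : ℕ} (hi : i ≤ m) {y : ℝ} (hy : y ∈ s) : p i y = if i = m then 1 else 0 :=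
    sum_iteratedDeriv_mul_wronskianDual (hW y hy) hi
  have hp0' {i : ℕ} (hi : i ≤ m) {y : ℝ} (hy : y ∈ s) : deriv (p i) y = 0 := by
    have : p i =ᶠ[𝓝 y] fun _ => if i = m then 1 else 0 := by
      filter_upwards [hs.mem_nhds hy] with z hz using hp0 hi hz
    rw [this.deriv_eq, deriv_const]
  have hp' (i : ℕ) (hi : i ≤ m) : deriv (p (i + 1)) x = if i = m then w' else 0 := by
    split_ifs with h
    · subst h
      refine Filter.EventuallyEq.deriv_eq ?_
      filter_upwards [hs.mem_nhds hx] with z hz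
      exact sum_iteratedDeriv_succ_mul_wronskianDual hs hφ hz
    · exact hp0' (by omega) hx
  have hq (i : ℕ) (y : ℝ) (hy : y ∈ s) : deriv (p i) y =
      p (i + 1) y + ∑ k, iteratedDeriv i (φ k) y * deriv (ψ k) y := by
    rw [hp, deriv_sum_mul hs (hφ' i) hψ hy]
    simp only [iteratedDeriv_succ]
  have hq' (i : ℕ) (hi : i ≤ m) : ∑ k, iteratedDeriv i (φ k) x * deriv (deriv (ψ k)) x =
      p (i + 2) x - 2 * deriv (p (i + 1)) x := by
    have h1 : (fun y => ∑ k, iteratedDeriv i (φ k) y * deriv (ψ k) y) =ᶠ[𝓝 x]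
        fun y => -p (i + 1) y := by
      filter_upwards [hs.mem_nhds hx] with y hy
      linear_combination hp0' hi hy - hq i y hy
    have h2 := h1.deriv_eq
    rw [deriv_sum_mul hs (hφ' i) hψ' hx, deriv.fun_neg] at h2
    simp only [← iteratedDeriv_succ] at h2
    linear_combination h2 + hq (i + 1) x hx
  have hF (i : ℕ) (hi : i ≤ m) : ∑ k, iteratedDeriv i (φ k) x * (F k * ψ k x) =
      -p (i + 2) x + U x * p i x := by
    have h1 : ∑ k, iteratedDeriv i (φ k) x * (F k * ψ k x) = -p (i + 2) x +
        ∑ l ∈ Finset.range (i + 1), (i.choose l) * iteratedDeriv l U x * p (i - l) x := by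
      simp only [hp, Finset.mul_sum]
      rw [Finset.sum_comm, ← Finset.sum_neg_distrib, ← Finset.sum_add_distrib]
      refine Finset.sum_congr rfl fun k _ => ?_
      have h2 := iteratedDeriv_schrodinger hs hU (hφ k) (heqφ k) i hx
      simp only [← mul_assoc]
      rw [← Finset.sum_mul]
      linear_combination ψ k x * h2
    rw [h1, Finset.sum_range_succ', Finset.sum_eq_zero]
    · simp
    · intro l hl
      rw [Finset.mem_range] at hl
      rw [hp0 (by omega) hx, if_neg (by omega), mul_zero]
  have hv := Matrix.eq_zero_of_mulVec_eq_zero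
    (M := Matrix.of fun j k : Fin (m + 1) => iteratedDeriv (j : ℕ) (φ k) x) (hW x hx)
    (v := fun k => -(deriv (deriv (ψ k)) x) + (U x - 2 * w') * ψ k x - F k * ψ k x) ?_
  · exact sub_eq_zero.1 (congrFun hv j)
  · ext i
    have hi : (i : ℕ) ≤ m := Nat.lt_succ_iff.1 i.2
    have h1 : ∑ k, iteratedDeriv (i : ℕ) (φ k) x *
        (-(deriv (deriv (ψ k)) x) + (U x - 2 * w') * ψ k x - F k * ψ k x) =
        -(∑ k, iteratedDeriv (i : ℕ) (φ k) x * deriv (deriv (ψ k)) x) +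
          (U x - 2 * w') * p i x - ∑ k, iteratedDeriv (i : ℕ) (φ k) x * (F k * ψ k x) := by
      simp only [hp, Finset.mul_sum]
      rw [← Finset.sum_neg_distrib, ← Finset.sum_add_distrib, ← Finset.sum_sub_distrib]
      exact Finset.sum_congr rfl fun k _ => by ring
    refine h1.trans ?_
    rw [hq' i hi, hF i hi, hp' i hi, hp0 hi hx, Pi.zero_apply]
    split_ifs <;> ring

/-- Darboux's theorem (second part): after an `M = m+1`-step Darboux transformation in terms of
the seed solutions `φ₁,…,φ_M`, the quotient obtained by omitting `φⱼ` from the numerator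
Wronskian, `φⱼ⁽ᴹ⁾ = W[φ₁,…,φ̆ⱼ,…,φ_M] / W[φ₁,…,φ_M]`, solves the deformed equation with the
potential `U⁽ᴹ⁾ = U - 2 (W''/W - (W'/W)²)` at the energy `Fⱼ` of the omitted seed. -/
theorem stmt_2 (a b : ℝ) (m : ℕ) (U : ℝ → ℂ)
    (φ : Fin (m + 1) → ℝ → ℂ) (F : Fin (m + 1) → ℂ)
    (hU : ContDiffOn ℝ (⊤ : ℕ∞) U (Set.Ioo a b))
    (hφ : ∀ j, ContDiffOn ℝ (⊤ : ℕ∞) (φ j) (Set.Ioo a b))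
    (heqφ : ∀ j, ∀ x ∈ Set.Ioo a b,
      -(deriv (deriv (φ j)) x) + U x * φ j x = F j * φ j x)
    (hW : ∀ x ∈ Set.Ioo a b, wronskian (m + 1) φ x ≠ 0)
    (j : Fin (m + 1)) :
    ∀ x ∈ Set.Ioo a b,
      -(deriv (deriv (fun y =>
          wronskian m (fun i => φ (j.succAbove i)) y / wronskian (m + 1) φ y)) x)
        + (U x - 2 * (deriv (deriv (wronskian (m + 1) φ)) x / wronskian (m + 1) φ x
            - (deriv (wronskian (m + 1) φ) x / wronskian (m + 1) φ x) ^ 2))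
          * (wronskian m (fun i => φ (j.succAbove i)) x / wronskian (m + 1) φ x)
      = F j * (wronskian m (fun i => φ (j.succAbove i)) x / wronskian (m + 1) φ x) := by
  intro x hx
  have hs : IsOpen (Set.Ioo a b) := isOpen_Ioo
  have h := schrodinger_wronskianDual hs hU hφ heqφ hW hx j
  have hWs := contDiffOn_wronskian hs hφ
  have hd {f : ℝ → ℂ} (hf : ContDiffOn ℝ ∞ f (Set.Ioo a b)) : DifferentiableAt ℝ f x :=
    (hf.contDiffAt (hs.mem_nhds hx)).differentiableAt (by simp)
  have hw : deriv (fun y => deriv (wronskian (m + 1) φ) y / wronskian (m + 1) φ y) x =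
      deriv (deriv (wronskian (m + 1) φ)) x / wronskian (m + 1) φ x
        - (deriv (wronskian (m + 1) φ) x / wronskian (m + 1) φ x) ^ 2 := by
    have hx0 := hW x hx
    rw [deriv_fun_div (hd ((contDiffOn_infty_iff_deriv_of_isOpen hs).1 hWs).2) (hd hWs) hx0]
    field_simp
  have hψ : wronskianDual φ j = fun y => (-1) ^ (m + j : ℕ) *
      (wronskian m (fun i => φ (j.succAbove i)) y / wronskian (m + 1) φ y) := rfl
  rw [hw, hψ] at h
  simp only [deriv_const_mul_field'] at h
  refine mul_left_cancel₀ (pow_ne_zero (m + j : ℕ) (neg_ne_zero.2 (one_ne_zero (α := ℂ)))) ?_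
  linear_combination h
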